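/- When n is even, there exists a unique function P̄(x₀,δ), analytic in x₀ at x₀ = 0 with P̄(0,δ) = 0 and ∂P̄/∂x₀(0,δ) > 0, such that for all sufficiently small x₀: P(x₀,δ) = P̄(x₀,δ) for x₀ > 0, and P(x₀,δ) = P̄^{-1}(x₀,δ) for x₀ < 0, where P̄^{-1}(·,δ) denotes the local inverse of P̄(·,δ) at 0. -/

import Mathlib

open Set Filter Metric
open scoped Topology

/-- The superposition operator `φ ↦ G ∘ φ` of an analytic `G` is analytic on `C(K, E)`. -/
theorem AnalyticAt.exists_superposition {K E F : Type*} [TopologicalSpace K] [CompactSpace K]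
    [NormedAddCommGroup E] [NormedSpace ℝ E] [NormedAddCommGroup F] [NormedSpace ℝ F]
    [CompleteSpace F] {G : E → F} (hG : AnalyticAt ℝ G 0) :
    ∃ N : C(K, E) → C(K, F), AnalyticAt ℝ N 0 ∧ ∀ᶠ φ in 𝓝 0, ∀ t, N φ t = G (φ t) := by
  obtain ⟨p, R, hp⟩ := hG
  let P : FormalMultilinearSeries ℝ C(K, E) C(K, F) := fun k =>
    MultilinearMap.mkContinuous
      { toFun := fun φ => ⟨fun t => p k (fun i => φ i t), by fun_prop⟩
        map_update_add' := fun φ i x y => by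
          ext t
          convert ((p k).compContinuousLinearMap
            (fun _ => ContinuousMap.evalCLM ℝ t)).map_update_add φ i x y <;> rfl
        map_update_smul' := fun φ i c x => by
          ext t
          convert ((p k).compContinuousLinearMap
            (fun _ => ContinuousMap.evalCLM ℝ t)).map_update_smul φ i c x <;> rfl } ‖p k‖ (by
        intro φ
        refine (ContinuousMap.norm_le _ (by positivity)).2 fun t => ?_
        refine ((p k).le_opNorm _).trans ?_
        gcongr with i
        exact (φ i).norm_coe_le_norm t)
  have hP : ∀ k φ t, P k φ t = p k (fun i => φ i t) := fun _ _ _ => rfl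
  have hPp : ∀ k, ‖P k‖ ≤ ‖p k‖ := fun k =>
    MultilinearMap.mkContinuous_norm_le _ (norm_nonneg _) _
  have hrad : p.radius ≤ P.radius := FormalMultilinearSeries.radius_le_of_le hPp
  have hpos : 0 < P.radius := hp.r_pos.trans_le (hp.r_le.trans hrad)
  have hsum := P.hasFPowerSeriesOnBall hpos
  refine ⟨P.sum, hsum.analyticAt, ?_⟩
  filter_upwards [Metric.eball_mem_nhds (0 : C(K, E)) hp.r_pos] with φ hφ t
  have hφR : (‖φ‖ₑ : ENNReal) < R := by simpa using hφ
  have h1 := hsum.hasSum (y := φ) (by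
    simpa using hφR.trans_le (hp.r_le.trans hrad))
  have h2 := h1.mapL (ContinuousMap.evalCLM ℝ t)
  have h3 := hp.hasSum (y := φ t) (by
    have : ‖φ t‖ₑ ≤ ‖φ‖ₑ := enorm_le_iff_norm_le.2 (φ.norm_coe_le_norm t)
    simpa using this.trans_lt hφR)
  simp only [zero_add, ContinuousMap.evalCLM_apply, hP] at h2 h3
  exact h2.unique h3

/-- The Volterra operator on `C([0, T], ℝ)`. -/
theorem exists_volterra {T : ℝ} (hT : 0 ≤ T) :
    ∃ V : C(Icc (0 : ℝ) T, ℝ) →L[ℝ] C(Icc (0 : ℝ) T, ℝ),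
      ∀ φ t, V φ t = ∫ s in (0 : ℝ)..t, IccExtend hT φ s := by
  have hφint : ∀ (φ : C(Icc (0 : ℝ) T, ℝ)) (c d : ℝ),
      IntervalIntegrable (IccExtend hT φ) MeasureTheory.volume c d := fun φ c d =>
    (φ.continuous.Icc_extend').intervalIntegrable c d
  refine ⟨LinearMap.mkContinuous
    { toFun := fun φ => ⟨fun t => ∫ s in (0 : ℝ)..t, IccExtend hT φ s,
        (intervalIntegral.continuous_primitive (hφint φ) 0).comp continuous_subtype_val⟩
      map_add' := fun φ ψ => by
        ext t
        exact intervalIntegral.integral_add (hφint φ 0 t) (hφint ψ 0 t)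
      map_smul' := fun c φ => by
        ext t
        exact intervalIntegral.integral_smul c _ } T fun φ => ?_, fun φ t => rfl⟩
  refine (ContinuousMap.norm_le _ (by positivity)).2 fun t => ?_
  have := intervalIntegral.norm_integral_le_of_norm_le_const (a := 0) (b := (t : ℝ))
    (f := IccExtend hT φ) (C := ‖φ‖) (fun s _ => φ.norm_coe_le_norm _)
  refine this.trans ?_
  rw [sub_zero, abs_of_nonneg t.2.1, mul_comm]
  gcongr
  exact t.2.2

/-- The inverse function theorem in the analytic category. -/
theorem exists_analyticAt_rightInverse {E : Type*} [NormedAddCommGroup E] [NormedSpace ℝ E]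
    [CompleteSpace E] {Φ : E → E} (hΦ : AnalyticAt ℝ Φ 0) (h0 : Φ 0 = 0) (L : E ≃L[ℝ] E)
    (h1 : HasFDerivAt Φ (L : E →L[ℝ] E) 0) :
    ∃ Ψ : E → E, AnalyticAt ℝ Ψ 0 ∧ Ψ 0 = 0 ∧
      HasFDerivAt Ψ (L.symm : E →L[ℝ] E) 0 ∧ ∀ᶠ y in 𝓝 0, Φ (Ψ y) = y := by
  have hs : HasStrictFDerivAt Φ (L : E →L[ℝ] E) 0 := by
    have := hΦ.hasStrictFDerivAt
    rwa [h1.fderiv] at this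
  have hsrc := hs.mem_toOpenPartialHomeomorph_source
  have htgt := hs.image_mem_toOpenPartialHomeomorph_target
  have hcoe := hs.toOpenPartialHomeomorph_coe
  set e := hs.toOpenPartialHomeomorph Φ with he
  have hsymm : e.symm 0 = 0 := by
    have := e.left_inv hsrc
    rwa [hcoe, h0] at this
  rw [h0] at htgt
  refine ⟨e.symm, ?_, hsymm, ?_, ?_⟩
  · exact e.analyticAt_symm (i := L) htgt (by rw [hsymm, hcoe]; exact hΦ)
      (by rw [hsymm, hcoe]; exact h1.fderiv)
  · refine e.hasFDerivAt_symm htgt ?_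
    rw [hsymm, hcoe]; exact h1
  · filter_upwards [e.open_target.mem_nhds htgt] with y hy
    have := e.right_inv hy
    rwa [hcoe] at this

theorem eventually_forall_continuousMap_apply {K E : Type*} [TopologicalSpace K] [CompactSpace K]
    [NormedAddCommGroup E] {Q : E → Prop} (hQ : ∀ᶠ x in 𝓝 (0 : E), Q x) :
    ∀ᶠ φ in 𝓝 (0 : C(K, E)), ∀ t, Q (φ t) := by
  obtain ⟨ε, hε, h⟩ := Metric.eventually_nhds_iff.1 hQ
  filter_upwards [Metric.ball_mem_nhds (0 : C(K, E)) hε] with φ hφ t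
  refine h ?_
  rw [dist_zero_right]
  exact (φ.norm_coe_le_norm t).trans_lt (by simpa using hφ)

theorem hasDerivWithinAt_IccExtend_of_integral {T : ℝ} (hT : 0 ≤ T)
    {φ ψ : C(Icc (0 : ℝ) T, ℝ)} (h : ∀ t, ψ t = ∫ s in (0 : ℝ)..t, IccExtend hT φ s)
    (t : Icc (0 : ℝ) T) :
    HasDerivWithinAt (IccExtend hT ψ) (φ t) (Icc 0 T) t := by
  have hc : Continuous (IccExtend hT φ) := φ.continuous.Icc_extend'
  have h1 : HasDerivAt (fun u => ∫ s in (0 : ℝ)..u, IccExtend hT φ s) (IccExtend hT φ t) t :=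
    (hc.integral_hasStrictDerivAt 0 t).hasDerivAt
  rw [IccExtend_val] at h1
  refine h1.hasDerivWithinAt.congr (fun s hs => ?_) ?_
  · rw [IccExtend_of_mem hT _ hs, h]
  · rw [IccExtend_val, h]

/-- Division by the second coordinate with analytic quotient. -/
theorem exists_analyticAt_divide {G : ℝ × ℝ → ℝ} (hG : AnalyticAt ℝ G 0) :
    ∃ H : ℝ × ℝ → ℝ, AnalyticAt ℝ H 0 ∧ (∀ᶠ p in 𝓝 0, G p = G (p.1, 0) + p.2 * H p) ∧
      ∀ᶠ x in 𝓝 (0 : ℝ), H (x, 0) = fderiv ℝ G (x, 0) (0, 1) := by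
  have hDG : AnalyticAt ℝ (fun p => fderiv ℝ G p (0, 1)) 0 :=
    ((ContinuousLinearMap.apply ℝ ℝ ((0, 1) : ℝ × ℝ)).analyticAt _).comp hG.fderiv
  obtain ⟨N, hN, hNeq⟩ := hDG.exists_superposition (K := Icc (0 : ℝ) 1)
  obtain ⟨V, hV⟩ := exists_volterra (zero_le_one (α := ℝ))
  let L : ℝ × ℝ →L[ℝ] C(Icc (0 : ℝ) 1, ℝ × ℝ) :=
    (ContinuousLinearMap.fst ℝ ℝ ℝ).smulRight (ContinuousMap.const _ (1, 0)) +
    (ContinuousLinearMap.snd ℝ ℝ ℝ).smulRight ⟨fun t => (0, t), by fun_prop⟩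
  have hL : ∀ p t, L p t = (p.1, p.2 * t) := by
    intro p t
    simp [L]
  have hLt : Tendsto L (𝓝 0) (𝓝 0) := by
    simpa using L.continuous.tendsto 0
  let one : Icc (0 : ℝ) 1 := ⟨1, by simp⟩
  have hHeq : ∀ᶠ p in 𝓝 (0 : ℝ × ℝ), ∀ t, N (L p) t = fderiv ℝ G (p.1, p.2 * t) (0, 1) := by
    filter_upwards [hLt.eventually hNeq] with p hp t
    rw [hp, hL]
  refine ⟨fun p => V (N (L p)) one, ?_, ?_, ?_⟩
  · have h0 : AnalyticAt ℝ N (L 0) := by simpa using hN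
    have h1 := h0.comp (L.analyticAt 0)
    exact (((ContinuousMap.evalCLM ℝ one).comp V).analyticAt _).comp h1
  · have hdiff := hLt.eventually (eventually_forall_continuousMap_apply (K := Icc (0 : ℝ) 1)
      (hG.eventually_analyticAt))
    filter_upwards [hHeq, hdiff] with p hp hd
    have key : ∫ t in (0 : ℝ)..1, p.2 * IccExtend (zero_le_one (α := ℝ)) (N (L p)) t =
        G (p.1, p.2 * 1) - G (p.1, p.2 * 0) := by
      refine intervalIntegral.integral_eq_sub_of_hasDerivAt (f := fun t => G (p.1, p.2 * t))
        (fun t ht => ?_) ?_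
      · rw [uIcc_of_le zero_le_one] at ht
        have h1 := (hd ⟨t, ht⟩).differentiableAt.hasFDerivAt
        rw [hL] at h1
        have h2 : HasDerivAt (fun t : ℝ => (p.1, p.2 * t)) (0, p.2) t := by
          simpa using (hasDerivAt_const t p.1).prodMk ((hasDerivAt_id t).const_mul p.2)
        have h3 := h1.comp_hasDerivAt t h2
        rw [IccExtend_of_mem _ _ ht, hp]
        refine h3.congr_deriv ?_
        rw [show ((0 : ℝ), p.2) = p.2 • ((0 : ℝ), (1 : ℝ)) by simp, map_smul, smul_eq_mul]
      · exact (continuous_const.mul (N (L p)).continuous.Icc_extend').intervalIntegrable _ _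
    rw [intervalIntegral.integral_const_mul] at key
    rw [hV, key]
    simp
  · have ht : Tendsto (fun x : ℝ => (x, (0 : ℝ))) (𝓝 0) (𝓝 0) := by
      have : Continuous fun x : ℝ => (x, (0 : ℝ)) := by fun_prop
      exact this.tendsto 0
    filter_upwards [ht.eventually hHeq] with x hx
    rw [hV, intervalIntegral.integral_congr (g := fun _ => fderiv ℝ G (x, 0) (0, 1))]
    · simp [one]
    · intro t ht
      rw [uIcc_of_le zero_le_one] at ht
      simp only
      rw [IccExtend_of_mem _ _ ht, hx]
      simp

theorem hasFDerivAt_id_mul_of_eq_zero {A : Type*} [NormedCommRing A] [NormedAlgebra ℝ A]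
    {f : A → A} (hf : DifferentiableAt ℝ f 0) (h0 : f 0 = 0) :
    HasFDerivAt (fun q => q * f q) (0 : A →L[ℝ] A) 0 := by
  refine ((hasFDerivAt_id (𝕜 := ℝ) (0 : A)).mul hf.hasFDerivAt).congr_fderiv ?_
  simp [h0]

theorem hasFDerivAt_id_sub_comp {E : Type*} [NormedAddCommGroup E] [NormedSpace ℝ E]
    (V : E →L[ℝ] E) {f : E → E} {x : E} (hf : HasFDerivAt f (0 : E →L[ℝ] E) x) :
    HasFDerivAt (fun q => q - V (f q))
      ((ContinuousLinearEquiv.refl ℝ E : E ≃L[ℝ] E) : E →L[ℝ] E) x := by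
  refine ((hasFDerivAt_id (𝕜 := ℝ) x).sub (V.hasFDerivAt.comp x hf)).congr_fderiv ?_
  ext
  simp

/-- Solutions of `ρ' = ρ * κ ρ` on `[0, T]` depend analytically on their initial value `r`
near `0`, even when `κ` acts on the whole curve. -/
theorem exists_analyticAt_flow {T : ℝ} (hT : 0 ≤ T)
    {κ : C(Icc (0 : ℝ) T, ℝ) → C(Icc (0 : ℝ) T, ℝ)} (hκ : AnalyticAt ℝ κ 0) :
    ∃ (ρ : ℝ → C(Icc (0 : ℝ) T, ℝ)) (e : C(Icc (0 : ℝ) T, ℝ)),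
      AnalyticAt ℝ ρ 0 ∧ ρ 0 = 0 ∧ (∀ t, 0 < e t) ∧ HasDerivAt ρ e 0 ∧
      ∀ᶠ r in 𝓝 0, ρ r ⟨0, left_mem_Icc.2 hT⟩ = r ∧
        ∀ t, HasDerivWithinAt (IccExtend hT (ρ r)) (ρ r t * κ (ρ r) t) (Icc 0 T) t := by
  obtain ⟨V, hV⟩ := exists_volterra hT
  let e : C(Icc (0 : ℝ) T, ℝ) := ⟨fun t => Real.exp (V (κ 0) t), by fun_prop⟩
  have he : ∀ t, e t = Real.exp (V (κ 0) t) := fun _ => rfl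
  let Φ : C(Icc (0 : ℝ) T, ℝ) → C(Icc (0 : ℝ) T, ℝ) := fun q =>
    q - V (q * (κ (e * q) - κ 0))
  have hmul : AnalyticAt ℝ (fun q : C(Icc (0 : ℝ) T, ℝ) => e * q) 0 :=
    analyticAt_const.mul analyticAt_id
  have hκe : AnalyticAt ℝ (fun q => κ (e * q)) 0 :=
    AnalyticAt.comp (g := κ) (by simpa using hκ) hmul
  have hin : AnalyticAt ℝ (fun q => q * (κ (e * q) - κ 0)) 0 :=
    analyticAt_id.mul (hκe.sub analyticAt_const)
  have hΦ : AnalyticAt ℝ Φ 0 := analyticAt_id.sub ((V.analyticAt _).comp hin)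
  have hΦ0 : Φ 0 = 0 := by simp [Φ]
  have hin' : HasFDerivAt (fun q => q * (κ (e * q) - κ 0))
      (0 : C(Icc (0 : ℝ) T, ℝ) →L[ℝ] C(Icc (0 : ℝ) T, ℝ)) 0 :=
    hasFDerivAt_id_mul_of_eq_zero (hκe.sub analyticAt_const).differentiableAt (by simp)
  have hΦ' : HasFDerivAt Φ ((ContinuousLinearEquiv.refl ℝ C(Icc (0 : ℝ) T, ℝ) :
      C(Icc (0 : ℝ) T, ℝ) →L[ℝ] C(Icc (0 : ℝ) T, ℝ))) 0 :=
    hasFDerivAt_id_sub_comp V hin'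
  obtain ⟨Ψ, hΨ, hΨ0, hΨ', hΨinv⟩ := exists_analyticAt_rightInverse hΦ hΦ0 _ hΦ'
  have hc : AnalyticAt ℝ (fun r : ℝ => r • (1 : C(Icc (0 : ℝ) T, ℝ))) 0 :=
    analyticAt_id.smul analyticAt_const
  have hc' : HasDerivAt (fun r : ℝ => r • (1 : C(Icc (0 : ℝ) T, ℝ))) 1 0 := by
    simpa using (hasDerivAt_id (0 : ℝ)).smul_const (1 : C(Icc (0 : ℝ) T, ℝ))
  refine ⟨fun r => e * Ψ (r • 1), e, ?_, by simp [hΨ0], fun t => Real.exp_pos _, ?_, ?_⟩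
  · exact analyticAt_const.mul (AnalyticAt.comp (g := Ψ) (by simpa using hΨ) hc)
  · have h1 : HasFDerivAt Ψ (((ContinuousLinearEquiv.refl ℝ C(Icc (0 : ℝ) T, ℝ)).symm :
      C(Icc (0 : ℝ) T, ℝ) →L[ℝ] C(Icc (0 : ℝ) T, ℝ))) ((0 : ℝ) • 1) := by simpa using hΨ'
    have h2 := (h1.comp_hasDerivAt (0 : ℝ) hc').const_mul e
    simpa using h2
  · have ht : Tendsto (fun r : ℝ => r • (1 : C(Icc (0 : ℝ) T, ℝ))) (𝓝 0) (𝓝 0) := by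
      simpa using hc.continuousAt.tendsto
    filter_upwards [ht.eventually hΨinv] with r hr
    set q := Ψ (r • 1) with hq
    have hqV : ∀ t, q t = r + V (q * (κ (e * q) - κ 0)) t := by
      intro t
      have := DFunLike.congr_fun hr t
      simp only [Φ, ContinuousMap.sub_apply, ContinuousMap.smul_apply, ContinuousMap.one_apply,
        smul_eq_mul, mul_one] at this
      linarith
    have hV0 : ∀ φ, V φ ⟨0, left_mem_Icc.2 hT⟩ = 0 := fun φ => by simp [hV]
    refine ⟨?_, fun t => ?_⟩
    · rw [ContinuousMap.mul_apply, he, hqV, hV0, hV0]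
      simp
    · have h1 := hasDerivWithinAt_IccExtend_of_integral hT (hV (κ 0)) t
      have h2 := hasDerivWithinAt_IccExtend_of_integral hT (hV (q * (κ (e * q) - κ 0))) t
      have h3 := h1.exp.mul (h2.const_add r)
      have hext : ∀ φ : C(Icc (0 : ℝ) T, ℝ), IccExtend hT φ t = φ t :=
        fun φ => IccExtend_val hT φ t
      have h4 : IccExtend hT (e * q : C(Icc (0 : ℝ) T, ℝ)) = fun s =>
          Real.exp (IccExtend hT (V (κ 0)) s) *
            (r + IccExtend hT (V (q * (κ (e * q) - κ 0))) s) := by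
        funext s
        simp only [IccExtend, Function.comp_apply, ContinuousMap.mul_apply, he, ← hqV]
      rw [h4]
      refine h3.congr_deriv ?_
      simp only [hext, ← hqV, ← he, ContinuousMap.mul_apply, ContinuousMap.sub_apply]
      ring

/-- Uniqueness for `c' = m t • v c` when only one solution is known to stay in `s`. -/
theorem eqOn_Icc_of_scaled_autonomous {E : Type*} [NormedAddCommGroup E] [NormedSpace ℝ E]
    {v : E → E} {s : Set E} {K : NNReal} (hs : IsOpen s) (hv : LipschitzOnWith K v s)
    {T : ℝ} {m : ℝ → ℝ} (hm : ContinuousOn m (Icc 0 T)) {c z : ℝ → E}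
    (hc : ∀ t ∈ Icc 0 T, HasDerivWithinAt c (m t • v (c t)) (Icc 0 T) t)
    (hcs : ∀ t ∈ Icc 0 T, c t ∈ s)
    (hz : ∀ t ∈ Icc 0 T, HasDerivWithinAt z (m t • v (z t)) (Icc 0 T) t)
    (h0 : c 0 = z 0) : EqOn c z (Icc 0 T) := by
  obtain ⟨C, hC⟩ := isCompact_Icc.exists_bound_of_continuousOn hm
  have hcc : ContinuousOn c (Icc 0 T) := fun t ht => (hc t ht).continuousWithinAt
  have hzc : ContinuousOn z (Icc 0 T) := fun t ht => (hz t ht).continuousWithinAt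
  have hlip : ∀ t ∈ Icc 0 T, LipschitzOnWith (C.toNNReal * K) (fun x => m t • v x) s := by
    intro t ht
    refine LipschitzOnWith.of_dist_le_mul fun x hx y hy => ?_
    rw [dist_smul₀, NNReal.coe_mul, mul_assoc]
    have := hv.dist_le_mul x hx y hy
    gcongr
    exact (hC t ht).trans (Real.le_coe_toNNReal C)
  have hclosed : IsClosed ({t | c t = z t} ∩ Icc 0 T) := by
    have := (hcc.sub hzc).preimage_isClosed_of_isClosed isClosed_Icc (isClosed_singleton (x := 0))
    convert this using 1
    ext t
    simp [sub_eq_zero, and_comm]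
  refine hclosed.Icc_subset_of_forall_mem_nhdsWithin h0 ?_
  rintro x ⟨hx, hx0, hxT⟩
  have hxI : x ∈ Icc 0 T := ⟨hx0, hxT.le⟩
  have hmem : ∀ᶠ t in 𝓝[≥] x, z t ∈ s ∧ t ∈ Icc 0 T := by
    have h1 : 𝓝[≥] x ≤ 𝓝[Icc 0 T] x :=
      (nhdsWithin_le_of_mem (Filter.mem_of_superset (Icc_mem_nhdsGE hxT)
        (Icc_subset_Icc_left hx0)))
    have hzx : z x ∈ s := by
      have : c x = z x := hx
      exact this ▸ hcs x hxI
    have h2 : ∀ᶠ t in 𝓝[Icc 0 T] x, z t ∈ s :=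
      (hzc x hxI).eventually (hs.mem_nhds hzx)
    exact h1 (h2.and self_mem_nhdsWithin)
  obtain ⟨y, hxy, hy⟩ := (mem_nhdsGE_iff_exists_Icc_subset).1 hmem
  have hmem' : ∀ t ∈ Icc x y, z t ∈ s ∧ t ∈ Icc 0 T := fun t ht => hy ht
  have hsub : Icc x y ⊆ Icc 0 T := fun t ht => (hmem' t ht).2
  have hyT : y ≤ T := (hsub ⟨le_of_lt hxy, le_rfl⟩).2
  have hnhds : ∀ t ∈ Ico x y, Icc 0 T ∈ 𝓝[≥] t := fun t ht =>
    Filter.mem_of_superset (Icc_mem_nhdsGE (ht.2.trans_le hyT))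
      (Icc_subset_Icc_left (hx0.trans ht.1))
  have heq : EqOn c z (Icc x y) := by
    refine ODE_solution_unique_of_mem_Icc_right (v := fun t x => m t • v x) (s := fun _ => s)
      (K := C.toNNReal * K) (fun t ht => hlip t (hsub (Ico_subset_Icc_self ht)))
      (hcc.mono hsub) (fun t ht => ?_) (fun t ht => hcs t (hsub (Ico_subset_Icc_self ht)))
      (hzc.mono hsub) (fun t ht => ?_) (fun t ht => (hmem' t (Ico_subset_Icc_self ht)).1) hx
    · exact (hc t (hsub (Ico_subset_Icc_self ht))).mono_of_mem_nhdsWithin (hnhds t ht)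
    · exact (hz t (hsub (Ico_subset_Icc_self ht))).mono_of_mem_nhdsWithin (hnhds t ht)
  exact Filter.mem_of_superset (Ioc_mem_nhdsGT hxy)
    fun t ht => heq (Ioc_subset_Icc_self ht)

/-- An orbit of `v` traversing, with positive speed `m`, a curve `c` whose endpoint is its first
point satisfying `R`, has that endpoint as its first point satisfying `R`. -/
theorem first_hit_eq_of_reparametrization {E : Type*} [NormedAddCommGroup E] [NormedSpace ℝ E]
    {v : E → E} {s : Set E} {K : NNReal} (hs : IsOpen s) (hv : LipschitzOnWith K v s)
    {T : ℝ} (hT : 0 < T) {m : ℝ → ℝ} (hm : ContinuousOn m (Icc 0 T))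
    (hmpos : ∀ t ∈ Icc 0 T, 0 < m t) {c γ : ℝ → E}
    (hc : ∀ t ∈ Icc 0 T, HasDerivWithinAt c (m t • v (c t)) (Icc 0 T) t)
    (hcs : ∀ t ∈ Icc 0 T, c t ∈ s) (hγ : ∀ t, HasDerivAt γ (v (γ t)) t) (h0 : γ 0 = c 0)
    {R : E → Prop} (hR : R (c T)) (hnR : ∀ t ∈ Ioo 0 T, ¬R (c t)) {τ : ℝ} (hτ : 0 < τ)
    (hRτ : R (γ τ)) (hmin : ∀ t, 0 < t → t < τ → ¬R (γ t)) : γ τ = c T := by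
  let μ : ℝ → ℝ := IccExtend hT.le ((Icc 0 T).domRestrict m)
  have hμ : Continuous μ := (continuousOn_iff_continuous_domRestrict.1 hm).Icc_extend'
  have hμm : ∀ t ∈ Icc 0 T, μ t = m t := fun t ht => IccExtend_of_mem hT.le _ ht
  have hμpos : ∀ t, 0 < μ t := fun t => hmpos _ (projIcc 0 T hT.le t).2
  let θ : ℝ → ℝ := fun t => ∫ u in (0 : ℝ)..t, μ u
  have hθ : ∀ t, HasDerivAt θ (μ t) t := fun t => (hμ.integral_hasStrictDerivAt 0 t).hasDerivAt
  have hθ0 : θ 0 = 0 := intervalIntegral.integral_same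
  have hθmono : StrictMono θ := strictMono_of_hasDerivAt_pos hθ hμpos
  have hθc : Continuous θ := continuous_iff_continuousAt.2 fun t => (hθ t).continuousAt
  have heq : EqOn c (γ ∘ θ) (Icc 0 T) := by
    refine eqOn_Icc_of_scaled_autonomous hs hv hm hc hcs (fun t ht => ?_) (by simp [hθ0, h0])
    rw [← hμm t ht]
    exact ((hγ (θ t)).scomp t (hθ t)).hasDerivWithinAt
  have hθT : 0 < θ T := hθ0 ▸ hθmono hT
  have hle : τ ≤ θ T := by
    by_contra! h
    exact hmin _ hθT h (by rw [← Function.comp_apply (f := γ), ← heq ⟨hT.le, le_rfl⟩]; exact hR)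
  rcases hle.eq_or_lt with h | h
  · rw [h, ← Function.comp_apply (f := γ), ← heq ⟨hT.le, le_rfl⟩]
  · obtain ⟨t, ht, rfl⟩ : τ ∈ θ '' Ioo 0 T :=
      intermediate_value_Ioo hT.le hθc.continuousOn ⟨hθ0.symm ▸ hτ, h⟩
    refine absurd ?_ (hnR t ht)
    rw [heq (Ioo_subset_Icc_self ht)]
    exact hRτ

theorem fderiv_apply_snd_eq {G : ℝ × ℝ → ℝ} {p : ℝ × ℝ} {d : ℝ} (hG : DifferentiableAt ℝ G p)
    (h : HasDerivAt (fun u => G (p.1, u)) d p.2) : fderiv ℝ G p (0, 1) = d := by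
  have h2 : HasDerivAt (fun u : ℝ => (p.1, u)) (0, 1) p.2 :=
    (hasDerivAt_const p.2 p.1).prodMk (hasDerivAt_id p.2)
  exact (hG.hasFDerivAt.comp_hasDerivAt p.2 h2).unique h

theorem fderiv_apply_fst_eq {G : ℝ × ℝ → ℝ} {p : ℝ × ℝ} {d : ℝ} (hG : DifferentiableAt ℝ G p)
    (h : HasDerivAt (fun x => G (x, p.2)) d p.1) : fderiv ℝ G p (1, 0) = d := by
  have h2 : HasDerivAt (fun x : ℝ => (x, p.2)) (1, 0) p.1 :=
    (hasDerivAt_id p.1).prodMk (hasDerivAt_const p.1 p.2)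
  exact (hG.hasFDerivAt.comp_hasDerivAt p.1 h2).unique h

/-- Shifting the nullcline `y = F x` to the axis `u = 0` brings the system to the form
`x' = u * M`, `u' = -g - f * u + u ^ 2 * N`. -/
theorem exists_lienard_form {X Y : ℝ × ℝ → ℝ} (hX : AnalyticAt ℝ X 0) (hY : AnalyticAt ℝ Y 0)
    (hX' : fderiv ℝ X 0 = 0) {F g f : ℝ → ℝ} (hF : AnalyticAt ℝ F 0) (hF0 : F 0 = 0)
    (hsol : ∀ᶠ x in 𝓝 0, F x + X (x, F x) = 0) (hg : ∀ᶠ x in 𝓝 0, g x = -Y (x, F x))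
    (hf : ∀ᶠ x in 𝓝 0,
      f x = -(fderiv ℝ X (x, F x) (1, 0) + fderiv ℝ Y (x, F x) (0, 1))) :
    ∃ M N : ℝ × ℝ → ℝ, AnalyticAt ℝ M 0 ∧ AnalyticAt ℝ N 0 ∧ M 0 = 1 ∧
      ∀ᶠ p : ℝ × ℝ in 𝓝 0, F p.1 + p.2 + X (p.1, F p.1 + p.2) = p.2 * M p ∧
        Y (p.1, F p.1 + p.2) = deriv F p.1 * (p.2 * M p) +
          (-g p.1 - f p.1 * p.2 + p.2 ^ 2 * N p) := by
  let sh : ℝ × ℝ → ℝ × ℝ := fun p => (p.1, F p.1 + p.2)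
  have hF1 : AnalyticAt ℝ (fun p : ℝ × ℝ => F p.1) 0 :=
    AnalyticAt.comp (g := F) (f := Prod.fst) hF analyticAt_fst
  have hdF1 : AnalyticAt ℝ (fun p : ℝ × ℝ => deriv F p.1) 0 :=
    AnalyticAt.comp (g := deriv F) (f := Prod.fst) hF.deriv analyticAt_fst
  have hsh : AnalyticAt ℝ sh 0 := analyticAt_fst.prod (hF1.add analyticAt_snd)
  have hsh0 : sh 0 = 0 := by simp [sh, hF0]
  let Mf : ℝ × ℝ → ℝ := fun p => F p.1 + p.2 + X (sh p)
  let Nf : ℝ × ℝ → ℝ := fun p => Y (sh p) - deriv F p.1 * Mf p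
  have hMf : AnalyticAt ℝ Mf 0 :=
    (hF1.add analyticAt_snd).add (AnalyticAt.comp (g := X) (by rwa [hsh0]) hsh)
  have hNf : AnalyticAt ℝ Nf 0 :=
    (AnalyticAt.comp (g := Y) (by rwa [hsh0]) hsh).sub (hdF1.mul hMf)
  obtain ⟨M, hM, hMeq, hM1⟩ := exists_analyticAt_divide hMf
  obtain ⟨N₁, hN₁, hN₁eq, hN₁1⟩ := exists_analyticAt_divide hNf
  obtain ⟨N, hN, hNeq, -⟩ := exists_analyticAt_divide hN₁
  have hax : Tendsto (fun x : ℝ => (x, (0 : ℝ))) (𝓝 0) (𝓝 0) :=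
    (by fun_prop : Continuous fun x : ℝ => (x, (0 : ℝ))).tendsto 0
  have hgr : Tendsto (fun x : ℝ => (x, F x)) (𝓝 0) (𝓝 0) := by
    have : Tendsto (fun x : ℝ => (x, F x)) (𝓝 0) (𝓝 (0, F 0)) :=
      (continuousAt_id.prodMk hF.continuousAt).tendsto
    rw [hF0] at this
    exact this
  have hXd := (hgr.eventually hX.eventually_analyticAt)
  have hYd := (hgr.eventually hY.eventually_analyticAt)
  have hshift : ∀ x : ℝ, HasDerivAt (fun u : ℝ => (x, F x + u)) (0, 1) 0 := fun x =>
    (hasDerivAt_const 0 x).prodMk ((hasDerivAt_id 0).const_add (F x))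
  have hlineX : ∀ x, DifferentiableAt ℝ X (x, F x) →
      HasDerivAt (fun u => Mf (x, u)) (1 + fderiv ℝ X (x, F x) (0, 1)) 0 := by
    intro x hx
    have h1 : HasFDerivAt X (fderiv ℝ X (x, F x)) (x, F x + 0) := by
      rw [add_zero]; exact hx.hasFDerivAt
    exact ((hasDerivAt_id (0 : ℝ)).const_add (F x)).add
      (h1.comp_hasDerivAt (0 : ℝ) (hshift x))
  have hMfx : ∀ᶠ x in 𝓝 (0 : ℝ),
      fderiv ℝ Mf (x, 0) (0, 1) = 1 + fderiv ℝ X (x, F x) (0, 1) := by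
    filter_upwards [hXd, hax.eventually hMf.eventually_analyticAt] with x hx hm
    exact fderiv_apply_snd_eq hm.differentiableAt (hlineX x hx.differentiableAt)
  have hNfx : ∀ᶠ x in 𝓝 (0 : ℝ), N₁ (x, 0) = -f x := by
    filter_upwards [hXd, hYd, hax.eventually hNf.eventually_analyticAt, hN₁1, hf,
      hsol.eventually_nhds, hF.eventually_analyticAt] with x hx hy hn h1 hfx hs hFx
    have hF' : HasDerivAt F (deriv F x) x := hFx.differentiableAt.hasDerivAt
    have h2 : HasDerivAt (fun u => Nf (x, u)) (fderiv ℝ Y (x, F x) (0, 1) -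
        deriv F x * (1 + fderiv ℝ X (x, F x) (0, 1))) 0 := by
      have h1 : HasFDerivAt Y (fderiv ℝ Y (x, F x)) (x, F x + 0) := by
        rw [add_zero]; exact hy.differentiableAt.hasFDerivAt
      exact (h1.comp_hasDerivAt (0 : ℝ) (hshift x)).sub
        ((hlineX x hx.differentiableAt).const_mul (deriv F x))
    have h3 : deriv F x + fderiv ℝ X (x, F x) (1, deriv F x) = 0 := by
      have h4 : HasDerivAt (fun x => F x + X (x, F x))
          (deriv F x + fderiv ℝ X (x, F x) (1, deriv F x)) x :=
        hF'.add (hx.differentiableAt.hasFDerivAt.comp_hasDerivAt x ((hasDerivAt_id x).prodMk hF'))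
      exact h4.unique ((hasDerivAt_const x (0 : ℝ)).congr_of_eventuallyEq hs)
    have h5 : fderiv ℝ X (x, F x) (1, deriv F x) =
        fderiv ℝ X (x, F x) (1, 0) + deriv F x * fderiv ℝ X (x, F x) (0, 1) := by
      rw [← smul_eq_mul, ← map_smul, ← map_add]
      simp
    rw [h1, fderiv_apply_snd_eq hn.differentiableAt h2, hfx]
    linarith
  refine ⟨M, N, hM, hN, ?_, ?_⟩
  · have h1 := hM1.self_of_nhds
    have h2 := hMfx.self_of_nhds
    have h3 : ((0 : ℝ), (0 : ℝ)) = 0 := rfl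
    rw [hF0, h3] at h2
    rw [h3] at h1
    rw [h1, h2, hX']
    simp
  · have hfst : Tendsto (Prod.fst : ℝ × ℝ → ℝ) (𝓝 0) (𝓝 0) := continuous_fst.tendsto 0
    filter_upwards [hMeq, hN₁eq, hNeq, hfst.eventually hNfx, hfst.eventually hsol,
      hfst.eventually hg] with p h1 h2 h3 h4 h5 h6
    have hM0 : Mf (p.1, 0) = 0 := by simpa [Mf, sh] using h5
    have hN0 : Nf (p.1, 0) = -g p.1 := by
      simp only [Nf, hM0, sh, add_zero, h6]
      ring
    rw [hM0, zero_add] at h1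
    refine ⟨h1, ?_⟩
    have h7 : Y (p.1, F p.1 + p.2) = Nf p + deriv F p.1 * Mf p := by
      simp only [Nf, sh]
      ring
    rw [h7, h1, h2, hN0, h3, h4]
    ring

theorem quasihomogeneous_form_pos {n : ℕ} {a b c s : ℝ} (ha : 0 < a)
    (hb : b ^ 2 - 4 * n * a < 0) (hcs : s ^ 2 + c ^ 2 = 1) :
    0 < a * (c ^ n) ^ 2 - b * c ^ n * s + n * s ^ 2 := by
  by_cases hs : s = 0
  · have hc : c ≠ 0 := by
      rintro rfl
      simp [hs] at hcs
    have : 0 < (c ^ n) ^ 2 := by positivity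
    simp only [hs]
    nlinarith
  · have h1 : 0 < s ^ 2 := by positivity
    have h2 : 0 < (4 * n * a - b ^ 2) * s ^ 2 := mul_pos (by linarith) h1
    have h3 : 0 ≤ (2 * a * c ^ n - b * s) ^ 2 := sq_nonneg _
    have h4 : 0 < 4 * a * (a * (c ^ n) ^ 2 - b * c ^ n * s + n * s ^ 2) := by
      have : 4 * a * (a * (c ^ n) ^ 2 - b * c ^ n * s + n * s ^ 2) =
        (2 * a * c ^ n - b * s) ^ 2 + (4 * n * a - b ^ 2) * s ^ 2 := by ring
      rw [this]
      linarith
    exact pos_of_mul_pos_right h4 (by positivity)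

theorem exists_polar_coordinate_map {K : Type*} [TopologicalSpace K] [CompactSpace K]
    (c s : C(K, ℝ)) {n : ℕ} (hn : n ≠ 0) :
    ∃ pol : C(K, ℝ) → C(K, ℝ × ℝ), AnalyticAt ℝ pol 0 ∧ pol 0 = 0 ∧
      ∀ q t, pol q t = (q t * c t, -(q t ^ n * s t)) := by
  refine ⟨fun q => (ContinuousLinearMap.inl ℝ ℝ ℝ).compLeftContinuous ℝ K (q * c) +
    (ContinuousLinearMap.inr ℝ ℝ ℝ).compLeftContinuous ℝ K (-(q ^ n * s)), ?_, ?_, ?_⟩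
  · have h1 : AnalyticAt ℝ (fun q : C(K, ℝ) => q * c) 0 := analyticAt_id.mul analyticAt_const
    have h2 : AnalyticAt ℝ (fun q : C(K, ℝ) => -(q ^ n * s)) 0 :=
      ((analyticAt_id.pow n).mul analyticAt_const).neg
    exact ((ContinuousLinearMap.analyticAt _ _).comp h1).add
      ((ContinuousLinearMap.analyticAt _ _).comp h2)
  · ext t <;> simp [hn]
  · intro q t
    ext <;> simp

/-- In weighted polar coordinates `x = r * cos t`, `u = -r ^ n * sin t`, the Liénard form becomes
`dr/dt = r * κ`, with time satisfying `r ^ (n - 1) * dτ/dt = ν`. Here `n = k + 1`. -/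
theorem exists_polar_field {K : Type*} [TopologicalSpace K] [CompactSpace K]
    {c s : C(K, ℝ)} (hcs : ∀ t, s t ^ 2 + c t ^ 2 = 1) {k : ℕ}
    {M N : ℝ × ℝ → ℝ} {A B : ℝ → ℝ} (hM : AnalyticAt ℝ M 0) (hN : AnalyticAt ℝ N 0)
    (hA : AnalyticAt ℝ A 0) (hB : AnalyticAt ℝ B 0) (hM0 : M 0 = 1) (hA0 : 0 < A 0)
    (hAB : B 0 ^ 2 - 4 * (k + 1 : ℕ) * A 0 < 0) :
    ∃ κ ν : C(K, ℝ) → C(K, ℝ), AnalyticAt ℝ κ 0 ∧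
      ∀ᶠ q in 𝓝 0, ∀ t, 0 < ν q t ∧
        ∀ x u : ℝ, x = q t * c t → u = -(q t ^ (k + 1) * s t) →
          q t ^ (k + 1) * (κ q t * c t - s t) = ν q t * (u * M (x, u)) ∧
          -(q t ^ (2 * k + 1) * ((k + 1 : ℕ) * κ q t * s t + c t)) =
            ν q t * (-(x ^ (2 * k + 1) * A x) - x ^ k * B x * u + u ^ 2 * N (x, u)) := by
  obtain ⟨pol, hpol, hpol0, hpolt⟩ := exists_polar_coordinate_map c s k.succ_ne_zero
  obtain ⟨SM, hSM, hSMeq⟩ := hM.exists_superposition (K := K)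
  obtain ⟨SN, hSN, hSNeq⟩ := hN.exists_superposition (K := K)
  obtain ⟨SA, hSA, hSAeq⟩ := hA.exists_superposition (K := K)
  obtain ⟨SB, hSB, hSBeq⟩ := hB.exists_superposition (K := K)
  have hc : AnalyticAt ℝ (fun q : C(K, ℝ) => q * c) 0 := analyticAt_id.mul analyticAt_const
  let d : C(K, ℝ) := ContinuousMap.const K (k + 1 : ℝ)
  have hd : ∀ t, d t = k + 1 := fun _ => rfl
  let Z : C(K, ℝ) → C(K, ℝ) := fun q => -(s * SM (pol q))
  let U : C(K, ℝ) → C(K, ℝ) := fun q =>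
    -(c ^ (2 * k + 1) * SA (q * c)) + c ^ k * s * SB (q * c) + q * s ^ 2 * SN (pol q)
  let Δ : C(K, ℝ) → C(K, ℝ) := fun q => -(c * U q + d * (s * Z q))
  have hZ : AnalyticAt ℝ Z 0 :=
    (analyticAt_const.mul (AnalyticAt.comp (g := SM) (by rwa [hpol0]) hpol)).neg
  have hU : AnalyticAt ℝ U 0 :=
    (((analyticAt_const.mul (AnalyticAt.comp (g := SA) (by simpa using hSA) hc)).neg).add
      (analyticAt_const.mul (AnalyticAt.comp (g := SB) (by simpa using hSB) hc))).add
      ((analyticAt_id.mul analyticAt_const).mul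
        (AnalyticAt.comp (g := SN) (by rwa [hpol0]) hpol))
  have hΔ : AnalyticAt ℝ Δ 0 :=
    ((analyticAt_const.mul hU).add
      (analyticAt_const.mul (analyticAt_const.mul hZ))).neg
  have hΔ0 : ∀ t, 0 < Δ 0 t := by
    intro t
    have h1 := hSMeq.self_of_nhds t
    have h2 := hSAeq.self_of_nhds t
    have h3 := hSBeq.self_of_nhds t
    have h4 : Δ 0 t = A 0 * (c t ^ (k + 1)) ^ 2 - B 0 * c t ^ (k + 1) * s t +
        (k + 1 : ℕ) * s t ^ 2 := by
      simp only [ContinuousMap.zero_apply, hM0] at h1 h2 h3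
      simp only [Δ, U, Z, hpol0, zero_mul, add_zero, ContinuousMap.neg_apply,
        ContinuousMap.add_apply, ContinuousMap.mul_apply, ContinuousMap.pow_apply,
        hd, h1, h2, h3]
      push_cast
      ring
    rw [h4]
    exact quasihomogeneous_form_pos hA0 hAB (hcs t)
  have hpos : ∀ᶠ q in 𝓝 0, ∀ t, 0 < Δ q t := by
    have hopen : IsOpen {φ : C(K, ℝ) | MapsTo φ univ (Ioi 0)} :=
      ContinuousMap.isOpen_setOfPred_mapsTo isCompact_univ isOpen_Ioi
    filter_upwards [hΔ.continuousAt.eventually (hopen.mem_nhds fun t _ => hΔ0 t)] with q hq t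
    exact hq (mem_univ t)
  have hunit : ∀ φ : C(K, ℝ), (∀ t, 0 < φ t) → IsUnit φ := fun φ hφ =>
    ContinuousMap.isUnit_iff_forall_ne_zero φ |>.2 fun t => (hφ t).ne'
  obtain ⟨w, hw⟩ := hunit _ hΔ0
  have hinv : AnalyticAt ℝ (fun q => Ring.inverse (Δ q)) 0 :=
    AnalyticAt.comp (g := Ring.inverse) (by rw [← hw]; exact analyticAt_inverse w) hΔ
  refine ⟨fun q => (c * Z q - s * U q) * Ring.inverse (Δ q),
    fun q => (c ^ 2 + d * s ^ 2) * Ring.inverse (Δ q),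
    ((analyticAt_const.mul hZ).sub (analyticAt_const.mul hU)).mul hinv, ?_⟩
  have hpolt0 : Tendsto pol (𝓝 0) (𝓝 0) := by simpa [hpol0] using hpol.continuousAt.tendsto
  have hct0 : Tendsto (fun q : C(K, ℝ) => q * c) (𝓝 0) (𝓝 0) := by
    simpa using hc.continuousAt.tendsto
  filter_upwards [hpos, hpolt0.eventually hSMeq, hpolt0.eventually hSNeq,
    hct0.eventually hSAeq, hct0.eventually hSBeq] with q hq h1 h2 h3 h4 t
  have hI : Ring.inverse (Δ q) t = (Δ q t)⁻¹ := by
    have := DFunLike.congr_fun (Ring.mul_inverse_cancel _ (hunit _ hq)) t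
    exact eq_inv_of_mul_eq_one_right this
  have hD : 0 < c t ^ 2 + (k + 1 : ℝ) * s t ^ 2 := by
    have h5 := hcs t
    have h6 : 0 ≤ (k : ℝ) * s t ^ 2 := by positivity
    linarith
  have hΔne : Δ q t ≠ 0 := (hq t).ne'
  have hΔt : Δ q t = -(c t * U q t + (k + 1 : ℝ) * (s t * Z q t)) := rfl
  have hZt : Z q t = -(s t * M (pol q t)) := by rw [← h1]; rfl
  have hUt : U q t = -(c t ^ (2 * k + 1) * A (q t * c t)) + c t ^ k * s t * B (q t * c t) +
      q t * s t ^ 2 * N (pol q t) := by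
    have h3' : SA (q * c) t = A (q t * c t) := h3 t
    have h4' : SB (q * c) t = B (q t * c t) := h4 t
    rw [← h2, ← h3', ← h4']; rfl
  have hκt : ((c * Z q - s * U q) * Ring.inverse (Δ q)) t =
      (c t * Z q t - s t * U q t) / Δ q t := by
    rw [div_eq_mul_inv, ← hI]; rfl
  have hνt : ((c ^ 2 + d * s ^ 2) * Ring.inverse (Δ q)) t =
      (c t ^ 2 + (k + 1 : ℝ) * s t ^ 2) / Δ q t := by
    rw [div_eq_mul_inv, ← hI]; rfl
  simp only [hκt, hνt]
  refine ⟨div_pos hD (hq t), ?_⟩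
  rintro x u hx hu
  have hp : (x, u) = pol q t := by rw [hpolt, hx, hu]
  rw [hp]
  have e1 : u * M (pol q t) = q t ^ (k + 1) * Z q t := by rw [hZt, hu]; ring
  have e2 : -(x ^ (2 * k + 1) * A x) - x ^ k * B x * u + u ^ 2 * N (pol q t) =
      q t ^ (2 * k + 1) * U q t := by
    rw [hUt, hu, hx]
    ring
  rw [e1, e2]
  constructor
  · field_simp
    rw [hΔt]
    ring
  · push_cast
    field_simp
    rw [hΔt]
    ring

theorem eventually_mul_apply_pos_of_hasDerivAt {K : Type*} [TopologicalSpace K] [CompactSpace K]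
    {ρ : ℝ → C(K, ℝ)} {e : C(K, ℝ)} (hρ : HasDerivAt ρ e 0) (h0 : ρ 0 = 0) (he : ∀ t, 0 < e t) :
    ∀ᶠ r in 𝓝 0, r ≠ 0 → ∀ t, 0 < r * ρ r t := by
  rcases isEmpty_or_nonempty K with hK | hK
  · exact Eventually.of_forall fun r _ t => (hK.false t).elim
  obtain ⟨t₀, ht₀⟩ := e.continuous.exists_forall_le_of_hasCompactSupport
    (HasCompactSupport.of_compactSpace _)
  filter_upwards [(hasDerivAt_iff_isLittleO.1 hρ).def (half_pos (he t₀))] with r hr hr0 t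
  have h1 := ((ρ r - r • e).norm_coe_le_norm t).trans (by simpa [h0] using hr)
  rw [ContinuousMap.sub_apply, ContinuousMap.smul_apply, smul_eq_mul, Real.norm_eq_abs] at h1
  have h2 : |r * (ρ r t - r * e t)| ≤ |r| * (e t₀ / 2 * |r|) := by
    rw [abs_mul]
    gcongr
  have h3 : |r| * (e t₀ / 2 * |r|) = e t₀ / 2 * r ^ 2 := by
    rw [← sq_abs r]; ring
  rw [h3] at h2
  have h4 := (abs_le.1 h2).1
  have h5 : 0 < r ^ 2 := by positivity
  have h6 := mul_le_mul_of_nonneg_right (ht₀ t) h5.le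
  have h7 := mul_pos (he t₀) h5
  nlinarith

theorem Real.eq_pi_of_sin_eq_zero {t : ℝ} (ht : t ∈ Ioo 0 (2 * Real.pi))
    (h : Real.sin t = 0) : t = Real.pi := by
  rcases lt_trichotomy t Real.pi with h1 | h1 | h1
  · exact absurd h (Real.sin_pos_of_pos_of_lt_pi ht.1 h1).ne'
  · exact h1
  · have := Real.sin_neg_of_neg_of_neg_pi_lt (x := t - 2 * Real.pi) (by linarith [ht.2])
      (by linarith)
    rw [Real.sin_sub_two_pi] at this
    exact absurd h this.ne

/-- Derivative of the curve with weighted polar coordinates `(r t, t)` in the original plane. -/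
theorem hasDerivWithinAt_polar_curve {S : Set ℝ} {r : ℝ → ℝ} {t κ ν : ℝ} {k : ℕ}
    (hr : HasDerivWithinAt r (r t * κ) S t) (hrt : r t ≠ 0) {F : ℝ → ℝ} {x P Q : ℝ}
    (hx : x = r t * Real.cos t)
    (hF : DifferentiableAt ℝ F x)
    (h1 : r t ^ (k + 1) * (κ * Real.cos t - Real.sin t) = ν * P)
    (h2 : -(r t ^ (2 * k + 1) * ((k + 1 : ℕ) * κ * Real.sin t + Real.cos t)) = ν * Q) :
    HasDerivWithinAt
      (fun s => (r s * Real.cos s, F (r s * Real.cos s) + -(r s ^ (k + 1) * Real.sin s)))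
      ((ν / r t ^ k) • (P, deriv F x * P + Q)) S t := by
  have hrk : r t ^ k ≠ 0 := pow_ne_zero _ hrt
  have hX := hr.mul (Real.hasDerivAt_cos t).hasDerivWithinAt
  have hU := ((hr.pow (k + 1)).mul (Real.hasDerivAt_sin t).hasDerivWithinAt).neg
  have hF' : HasDerivAt F (deriv F x) (r t * Real.cos t) := hx ▸ hF.hasDerivAt
  have hFX := hF'.comp_hasDerivWithinAt t hX
  have hd1 : r t * κ * Real.cos t + r t * -Real.sin t = ν / r t ^ k * P := by
    field_simp
    rw [← h1]
    ring
  have hd2 : -((k + 1 : ℕ) * r t ^ k * (r t * κ) * Real.sin t +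
      r t ^ (k + 1) * Real.cos t) = ν / r t ^ k * Q := by
    field_simp
    rw [← h2]
    ring
  refine (hX.prodMk (hFX.add hU)).congr_deriv ?_
  simp only [Nat.add_sub_cancel, Prod.smul_mk, smul_eq_mul, Prod.mk.injEq, Pi.pow_apply]
  refine ⟨hd1, ?_⟩
  rw [hd1, hd2]
  ring

/-- The orbits near a monodromic nilpotent point are traced out by a family of closed-up spirals
whose endpoint `Pb r` is analytic in the starting abscissa `r`, of either sign. -/
theorem exists_analytic_spiral_family {X Y : ℝ × ℝ → ℝ} (hX : AnalyticAt ℝ X 0)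
    (hY : AnalyticAt ℝ Y 0) (hX' : fderiv ℝ X 0 = 0) {F g f A B : ℝ → ℝ}
    (hF : AnalyticAt ℝ F 0) (hF0 : F 0 = 0) (hsol : ∀ᶠ x in 𝓝 0, F x + X (x, F x) = 0)
    (hg : ∀ᶠ x in 𝓝 0, g x = -Y (x, F x))
    (hf : ∀ᶠ x in 𝓝 0,
      f x = -(fderiv ℝ X (x, F x) (1, 0) + fderiv ℝ Y (x, F x) (0, 1)))
    {k : ℕ} (hA : AnalyticAt ℝ A 0) (hB : AnalyticAt ℝ B 0) (hA0 : 0 < A 0)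
    (hAB : B 0 ^ 2 - 4 * (k + 1 : ℕ) * A 0 < 0)
    (hgA : ∀ᶠ x in 𝓝 0, g x = x ^ (2 * k + 1) * A x)
    (hfB : ∀ᶠ x in 𝓝 0, f x = x ^ k * B x) (hk : Odd k) {s : Set (ℝ × ℝ)} (hs : s ∈ 𝓝 0) :
    ∃ Pb : ℝ → ℝ, AnalyticAt ℝ Pb 0 ∧ Pb 0 = 0 ∧ 0 < deriv Pb 0 ∧
      ∀ᶠ r in 𝓝 0, r ≠ 0 → 0 < r * Pb r ∧ ∃ (c : ℝ → ℝ × ℝ) (m : ℝ → ℝ),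
        ContinuousOn m (Icc 0 (2 * Real.pi)) ∧
        (∀ t ∈ Icc 0 (2 * Real.pi), 0 < r * m t ∧ c t ∈ s ∧
          HasDerivWithinAt c (m t • ((c t).2 + X (c t), Y (c t))) (Icc 0 (2 * Real.pi)) t) ∧
        c 0 = (r, F r) ∧ c (2 * Real.pi) = (Pb r, F (Pb r)) ∧
        ∀ t ∈ Ioo 0 (2 * Real.pi), (c t).2 = F (c t).1 → r * (c t).1 < 0 := by
  have hT : (0 : ℝ) ≤ 2 * Real.pi := by positivity
  obtain ⟨M, N, hM, hN, hM0, hMN⟩ := exists_lienard_form hX hY hX' hF hF0 hsol hg hf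
  let co : C(Icc 0 (2 * Real.pi), ℝ) := ⟨fun t => Real.cos t, by fun_prop⟩
  let si : C(Icc 0 (2 * Real.pi), ℝ) := ⟨fun t => Real.sin t, by fun_prop⟩
  obtain ⟨κ, ν, hκ, hκν⟩ := exists_polar_field (c := co) (s := si)
    (fun t => Real.sin_sq_add_cos_sq t) hM hN hA hB hM0 hA0 hAB
  obtain ⟨pol, hpol, hpol0, hpolt⟩ := exists_polar_coordinate_map co si k.succ_ne_zero
  obtain ⟨ρ, e, hρ, hρ0, he, hρe, hflow⟩ := exists_analyticAt_flow hT hκ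
  have hρt : Tendsto ρ (𝓝 0) (𝓝 0) := by simpa [hρ0] using hρ.continuousAt.tendsto
  have hpt : Tendsto pol (𝓝 0) (𝓝 0) := by simpa [hpol0] using hpol.continuousAt.tendsto
  have hsh : Tendsto (fun p : ℝ × ℝ => (p.1, F p.1 + p.2)) (𝓝 0) (𝓝 0) := by
    have h1 : ContinuousAt (fun p : ℝ × ℝ => F p.1) 0 :=
      ContinuousAt.comp (g := F) (f := Prod.fst) hF.continuousAt continuousAt_fst
    have h2 : Tendsto (fun p : ℝ × ℝ => (p.1, F p.1 + p.2)) (𝓝 0) (𝓝 ((0 : ℝ), F 0 + 0)) :=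
      (continuousAt_fst.prodMk (h1.add continuousAt_snd)).tendsto
    rw [hF0, add_zero] at h2
    exact h2
  have hfst : Tendsto (Prod.fst : ℝ × ℝ → ℝ) (𝓝 0) (𝓝 0) := continuous_fst.tendsto 0
  have hnear := hpt.eventually (eventually_forall_continuousMap_apply
    (K := Icc 0 (2 * Real.pi)) (hMN.and ((hsh.eventually hs).and
      (hfst.eventually (hgA.and (hfB.and hF.eventually_analyticAt))))))
  let tend : Icc 0 (2 * Real.pi) := ⟨2 * Real.pi, right_mem_Icc.2 hT⟩
  let ev : C(Icc 0 (2 * Real.pi), ℝ) →L[ℝ] ℝ := ContinuousMap.evalCLM ℝ tend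
  have hev : HasDerivAt (fun r => ρ r tend) (e tend) 0 :=
    (ev.hasFDerivAt (x := ρ 0)).comp_hasDerivAt (0 : ℝ) hρe
  refine ⟨fun r => ρ r tend, ?_, by simp [hρ0], by rw [hev.deriv]; exact he _, ?_⟩
  · exact (ev.analyticAt _).comp hρ
  filter_upwards [eventually_mul_apply_pos_of_hasDerivAt hρe hρ0 he, hflow, hρt.eventually hκν,
    hρt.eventually hnear] with r hsign hfl hκr hnr hr0
  have hsign := hsign hr0
  obtain ⟨hstart, hder⟩ := hfl
  let R : ℝ → ℝ := IccExtend hT (ρ r)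
  have hR : ∀ t (ht : t ∈ Icc 0 (2 * Real.pi)), R t = ρ r ⟨t, ht⟩ := fun t ht =>
    IccExtend_of_mem hT _ ht
  have hRc : Continuous R := (ρ r).continuous.Icc_extend'
  have hRpos : ∀ t, 0 < r * R t := fun t => hsign _
  have hRne : ∀ t, R t ≠ 0 := fun t h => by simpa [h] using hRpos t
  let νe : ℝ → ℝ := IccExtend hT (ν (ρ r))
  have hνc : Continuous νe := (ν (ρ r)).continuous.Icc_extend'
  refine ⟨hsign _, fun t => (R t * Real.cos t, F (R t * Real.cos t) +
    -(R t ^ (k + 1) * Real.sin t)), fun t => νe t / R t ^ k, ?_, ?_, ?_, ?_, ?_⟩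
  · exact (hνc.div (hRc.pow k) fun t => pow_ne_zero _ (hRne t)).continuousOn
  · intro t ht
    obtain ⟨hνpos, hκt⟩ := hκr ⟨t, ht⟩
    obtain ⟨⟨hn1, hn2⟩, hn3, hn4, hn5, hn6⟩ := hnr ⟨t, ht⟩
    have hRt := hR t ht
    rw [hpolt, ← hRt] at hn1 hn2 hn3 hn4 hn5 hn6
    rw [← hRt] at hκt
    have hνt : νe t = ν (ρ r) ⟨t, ht⟩ := IccExtend_of_mem hT _ ht
    refine ⟨?_, hn3, ?_⟩
    · have h1 : 0 < R t ^ k * R t := by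
        rw [← pow_succ]
        exact hk.add_one.pow_pos (hRne t)
      have h2 : 0 < (r * R t) * (R t ^ k * R t) := mul_pos (hRpos t) h1
      have h3 : 0 < r * R t ^ k := by
        have h4 : (r * R t) * (R t ^ k * R t) = (r * R t ^ k) * R t ^ 2 := by ring
        rw [h4] at h2
        exact pos_of_mul_pos_left h2 (sq_nonneg _)
      have h5 : r * (νe t / R t ^ k) = νe t * (r * R t ^ k) / (R t ^ k) ^ 2 := by
        have := pow_ne_zero k (hRne t)
        field_simp
      rw [h5, hνt]
      have := pow_ne_zero k (hRne t)
      positivity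
    · obtain ⟨hk1, hk2⟩ := hκt _ _ rfl rfl
      have hd := hder ⟨t, ht⟩
      have hd' : HasDerivWithinAt R (R t * κ (ρ r) ⟨t, ht⟩) (Icc 0 (2 * Real.pi)) t := by
        rw [hRt]; exact hd
      have := hasDerivWithinAt_polar_curve (k := k) (F := F) hd' (hRne t) rfl
        hn6.differentiableAt hk1 hk2
      refine this.congr_deriv ?_
      have hco : co ⟨t, ht⟩ = Real.cos t := rfl
      have hsi : si ⟨t, ht⟩ = Real.sin t := rfl
      simp only [hco, hsi, Nat.succ_eq_add_one] at hn1 hn2 hn4 hn5 ⊢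
      rw [hn1, hn2, hn4, hn5, hνt]
  · have h0 : R 0 = r := (hR 0 (left_mem_Icc.2 hT)).trans hstart
    simp [h0]
  · have h1 : R (2 * Real.pi) = ρ r tend := hR _ (right_mem_Icc.2 hT)
    simp [h1]
  · intro t ht h
    have h1 : R t ^ (k + 1) * Real.sin t = 0 := by simpa using h
    have h2 : Real.sin t = 0 :=
      (mul_eq_zero.1 h1).resolve_left (pow_ne_zero _ (hRne t))
    have h3 := Real.eq_pi_of_sin_eq_zero ht h2
    have h4 := hRpos t
    simp only
    rw [h3, Real.cos_pi, ← h3]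
    linarith

/-- Analytic local inverse of a real function with nonvanishing derivative at its zero. -/
theorem exists_analyticAt_localInverse {p : ℝ → ℝ} (hp : AnalyticAt ℝ p 0) (h0 : p 0 = 0)
    (hd : deriv p 0 ≠ 0) :
    ∃ q : ℝ → ℝ, AnalyticAt ℝ q 0 ∧ q 0 = 0 ∧ ∀ᶠ y in 𝓝 0, p (q y) = y := by
  obtain ⟨q, hq, hq0, -, h⟩ := exists_analyticAt_rightInverse hp h0
    (ContinuousLinearEquiv.unitsEquivAut ℝ (Units.mk0 _ hd)) (by
      have h1 : ((ContinuousLinearEquiv.unitsEquivAut ℝ (Units.mk0 _ hd) : ℝ ≃L[ℝ] ℝ) :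
          ℝ →L[ℝ] ℝ) = ContinuousLinearMap.toSpanSingleton ℝ (deriv p 0) := by
        ext
        simp
      rw [h1]
      exact hp.differentiableAt.hasDerivAt.hasFDerivAt)
  exact ⟨q, hq, hq0, h⟩

/-- Time reversal of a curve on `[0, T]`. -/
theorem hasDerivWithinAt_comp_const_sub_Icc {E : Type*} [NormedAddCommGroup E] [NormedSpace ℝ E]
    {c : ℝ → E} {e : E} {T t : ℝ} (h : HasDerivWithinAt c e (Icc 0 T) (T - t)) :
    HasDerivWithinAt (fun t => c (T - t)) (-e) (Icc 0 T) t := by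
  have h1 : HasDerivWithinAt (fun t : ℝ => T - t) (-1) (Icc 0 T) t :=
    ((hasDerivAt_id t).const_sub T).hasDerivWithinAt
  have h2 := h.scomp t h1 (fun s hs => ⟨by linarith [hs.2], by linarith [hs.1]⟩)
  simpa [Function.comp_def] using h2

/-- **Theorem 1.4(2).**  For system (1.9) `x' = y + X(x,y,δ)`, `y' = Y(x,y,δ)`
satisfying (1.11) and (1.12) for all `δ` in a compact set `D`, if `n` is even then
there is a unique function `P̄(·,δ)`, analytic at `x₀ = 0` with `P̄(0,δ) = 0` and
`∂P̄/∂x₀(0,δ) > 0`, such that the Poincaré return map satisfies `P(x₀,δ) = P̄(x₀,δ)`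
for small `x₀ > 0` and `P(x₀,δ) = P̄^{-1}(x₀,δ)` (local inverse of `P̄` at `0`)
for small `x₀ < 0`; the inverse relation is expressed as `P̄(P(x₀,δ)) = x₀`. -/
theorem poincare_map_piecewise_analytic_of_even
    (n mp : ℕ) (hn : 2 ≤ n) (heven : Even n)
    (D : Set (Fin mp → ℝ)) (hD : IsCompact D)
    (XX YY : ℝ → ℝ → (Fin mp → ℝ) → ℝ)
    (hXana : ∀ δ ∈ D, AnalyticAt ℝ
      (fun p : ℝ × ℝ × (Fin mp → ℝ) => XX p.1 p.2.1 p.2.2) (0, 0, δ))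
    (hYana : ∀ δ ∈ D, AnalyticAt ℝ
      (fun p : ℝ × ℝ × (Fin mp → ℝ) => YY p.1 p.2.1 p.2.2) (0, 0, δ))
    (hXsmall : ∀ δ ∈ D,
      (fun p : ℝ × ℝ => XX p.1 p.2 δ) =O[nhds (0 : ℝ × ℝ)] fun p => ‖p‖ ^ 2)
    (hYsmall : ∀ δ ∈ D,
      (fun p : ℝ × ℝ => YY p.1 p.2 δ) =O[nhds (0 : ℝ × ℝ)] fun p => ‖p‖ ^ 2)
    -- `y = F(x,δ)` is the analytic solution of `y + X(x,y,δ) = 0`, `F(0,δ) = 0`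
    (F : ℝ → (Fin mp → ℝ) → ℝ)
    (hFana : ∀ δ ∈ D, AnalyticAt ℝ (fun x => F x δ) 0)
    (hF0 : ∀ δ ∈ D, F 0 δ = 0)
    (hFsol : ∀ δ ∈ D, ∀ᶠ x in nhds (0 : ℝ), F x δ + XX x (F x δ) δ = 0)
    -- the functions (1.10)
    (g f : ℝ → (Fin mp → ℝ) → ℝ)
    (hgdef : ∀ δ ∈ D, ∀ x, g x δ = -YY x (F x δ) δ)
    (hfdef : ∀ δ ∈ D, ∀ x, f x δ =
      -(deriv (fun s => XX s (F x δ) δ) x + deriv (fun s => YY x s δ) (F x δ)))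
    -- condition (1.11)
    (a : (Fin mp → ℝ) → ℝ) (ha : ∀ δ ∈ D, 0 < a δ)
    (hg11 : ∀ δ ∈ D, ∃ u : ℝ → ℝ, AnalyticAt ℝ u 0 ∧ u 0 = a δ ∧
      ∀ᶠ x in nhds (0 : ℝ), g x δ = x ^ (2 * n - 1) * u x)
    -- condition (1.12)
    (b : (Fin mp → ℝ) → ℝ)
    (hf12 : ∀ δ ∈ D, ∃ w : ℝ → ℝ, AnalyticAt ℝ w 0 ∧ w 0 = b δ ∧
      ∀ᶠ x in nhds (0 : ℝ), f x δ = x ^ (n - 1) * w x)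
    (hb : ∀ δ ∈ D, (b δ) ^ 2 - 4 * n * a δ < 0)
    -- the Poincaré return map
    (P : ℝ → (Fin mp → ℝ) → ℝ)
    (hP0 : ∀ δ ∈ D, P 0 δ = 0)
    (hP : ∀ δ ∈ D, ∃ ε > 0, ∀ x₀ : ℝ, x₀ ≠ 0 → |x₀| < ε →
      ∃ γ : ℝ → ℝ × ℝ, γ 0 = (x₀, F x₀ δ) ∧
        (∀ t : ℝ,
          HasDerivAt (fun s => (γ s).1) ((γ t).2 + XX (γ t).1 (γ t).2 δ) t ∧
          HasDerivAt (fun s => (γ s).2) (YY (γ t).1 (γ t).2 δ) t) ∧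
        ∃ τ : ℝ, 0 < τ ∧
          ((γ τ).2 = F (γ τ).1 δ ∧ 0 < x₀ * (γ τ).1) ∧
          (∀ t : ℝ, 0 < t → t < τ →
            ¬((γ t).2 = F (γ t).1 δ ∧ 0 < x₀ * (γ t).1)) ∧
          P x₀ δ = (γ τ).1) :
    ∀ δ ∈ D,
      ∃ Pb : ℝ → ℝ,
        (AnalyticAt ℝ Pb 0 ∧ Pb 0 = 0 ∧ 0 < deriv Pb 0 ∧
          (∀ᶠ x₀ in nhdsWithin (0 : ℝ) (Ioi 0), P x₀ δ = Pb x₀) ∧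
          (∀ᶠ x₀ in nhdsWithin (0 : ℝ) (Iio 0), Pb (P x₀ δ) = x₀)) ∧
        ∀ Pb' : ℝ → ℝ,
          (AnalyticAt ℝ Pb' 0 ∧ Pb' 0 = 0 ∧ 0 < deriv Pb' 0 ∧
            (∀ᶠ x₀ in nhdsWithin (0 : ℝ) (Ioi 0), P x₀ δ = Pb' x₀) ∧
            (∀ᶠ x₀ in nhdsWithin (0 : ℝ) (Iio 0), Pb' (P x₀ δ) = x₀)) →
          Pb' =ᶠ[nhds (0 : ℝ)] Pb := by
  intro δ hδ
  obtain ⟨k, rfl⟩ : ∃ k, n = k + 1 := ⟨n - 1, by omega⟩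
  have hk : Odd k := by
    rcases Nat.even_or_odd k with h | h
    · exact absurd heven (by simpa [Nat.even_add_one] using h)
    · exact h
  let X : ℝ × ℝ → ℝ := fun p => XX p.1 p.2 δ
  let Y : ℝ × ℝ → ℝ := fun p => YY p.1 p.2 δ
  let φ : ℝ → ℝ := fun x => F x δ
  have hins : AnalyticAt ℝ (fun p : ℝ × ℝ => (p.1, p.2, δ)) 0 :=
    analyticAt_fst.prod (analyticAt_snd.prod analyticAt_const)
  have hX : AnalyticAt ℝ X 0 := (hXana δ hδ).comp_of_eq hins rfl
  have hY : AnalyticAt ℝ Y 0 := (hYana δ hδ).comp_of_eq hins rfl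
  have hXO : X =O[𝓝 0] fun p => ‖p - 0‖ ^ 2 := by simpa only [sub_zero] using hXsmall δ hδ
  have hX' : fderiv ℝ X 0 = 0 := (hXO.hasFDerivAt one_lt_two).fderiv
  have hφ : AnalyticAt ℝ φ 0 := hFana δ hδ
  have hφ0 : φ 0 = 0 := hF0 δ hδ
  have hgraph : Tendsto (fun x => (x, φ x)) (𝓝 0) (𝓝 0) := by
    have h : Tendsto (fun x => (x, φ x)) (𝓝 0) (𝓝 ((0 : ℝ), φ 0)) :=
      (continuousAt_id.prodMk hφ.continuousAt).tendsto
    rw [hφ0] at h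
    exact h
  obtain ⟨A, hA, hA0, hgA⟩ := hg11 δ hδ
  obtain ⟨B, hB, hB0, hfB⟩ := hf12 δ hδ
  have hf : ∀ᶠ x in 𝓝 0,
      f x δ = -(fderiv ℝ X (x, φ x) (1, 0) + fderiv ℝ Y (x, φ x) (0, 1)) := by
    filter_upwards [hgraph.eventually (hX.eventually_analyticAt.and hY.eventually_analyticAt)]
      with x hx
    rw [hfdef δ hδ]
    have hdX : DifferentiableAt ℝ (fun s => X (s, φ x)) x :=
      DifferentiableAt.comp (g := X) x hx.1.differentiableAt (by fun_prop)
    have hdY : DifferentiableAt ℝ (fun s => Y (x, s)) (φ x) :=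
      DifferentiableAt.comp (g := Y) (φ x) hx.2.differentiableAt (by fun_prop)
    rw [fderiv_apply_fst_eq hx.1.differentiableAt hdX.hasDerivAt,
      fderiv_apply_snd_eq hx.2.differentiableAt hdY.hasDerivAt]
  let v : ℝ × ℝ → ℝ × ℝ := fun p => (p.2 + X p, Y p)
  have hv : ContDiffAt ℝ 1 v 0 := ((analyticAt_snd.add hX).prod hY).contDiffAt
  obtain ⟨K, s', hs', hlip'⟩ := hv.exists_lipschitzOnWith
  obtain ⟨s, hss', hs, h0s⟩ := _root_.mem_nhds_iff.1 hs'
  have hlip := hlip'.mono hss'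
  obtain ⟨Pb, hPb, hPb0, hPbd, hspiral⟩ := exists_analytic_spiral_family hX hY hX' hφ hφ0
    (hFsol δ hδ) (Eventually.of_forall (hgdef δ hδ)) hf hA hB (hA0 ▸ ha δ hδ)
    (by rw [hA0, hB0]; exact hb δ hδ) hgA hfB hk (hs.mem_nhds h0s)
  obtain ⟨ε, hε, hret⟩ := hP δ hδ
  have hsmall : ∀ᶠ x : ℝ in 𝓝 0, |x| < ε :=
    (continuous_abs.tendsto' 0 0 abs_zero).eventually_lt_const hε
  have hhit : ∀ x₀ : ℝ, x₀ ≠ 0 → |x₀| < ε → ∀ (c : ℝ → ℝ × ℝ) (m : ℝ → ℝ) (y : ℝ),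
      ContinuousOn m (Icc 0 (2 * Real.pi)) →
      (∀ t ∈ Icc 0 (2 * Real.pi), 0 < m t ∧ c t ∈ s ∧
        HasDerivWithinAt c (m t • v (c t)) (Icc 0 (2 * Real.pi)) t) →
      c 0 = (x₀, φ x₀) → c (2 * Real.pi) = (y, φ y) → 0 < x₀ * y →
      (∀ t ∈ Ioo 0 (2 * Real.pi), (c t).2 = φ (c t).1 → x₀ * (c t).1 < 0) → P x₀ δ = y := by
    intro x₀ hx₀ hxε c m y hm hc hc0 hcT hxy hno
    obtain ⟨γ, hγ0, hγ, τ, hτ, hRτ, hmin, hPτ⟩ := hret x₀ hx₀ hxε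
    have h := first_hit_eq_of_reparametrization hs hlip Real.two_pi_pos hm
      (fun t ht => (hc t ht).1) (fun t ht => (hc t ht).2.2) (fun t ht => (hc t ht).2.1)
      (γ := γ) (fun t => (hγ t).1.prodMk (hγ t).2) (hγ0.trans hc0.symm)
      (R := fun p => p.2 = φ p.1 ∧ 0 < x₀ * p.1) (by rw [hcT]; exact ⟨rfl, hxy⟩)
      (fun t ht h => (hno t ht h.1).not_gt h.2) hτ hRτ
      hmin
    rw [hPτ, h, hcT]
  have hright : ∀ᶠ x₀ in nhdsWithin (0 : ℝ) (Ioi 0), P x₀ δ = Pb x₀ := by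
    filter_upwards [self_mem_nhdsWithin, nhdsWithin_le_nhds hsmall,
      nhdsWithin_le_nhds hspiral] with x₀ hx hxε hsp
    have hx : 0 < x₀ := hx
    obtain ⟨hpos, c, m, hm, hc, hc0, hcT, hno⟩ := hsp hx.ne'
    exact hhit x₀ hx.ne' hxε c m (Pb x₀) hm
      (fun t ht => ⟨pos_of_mul_pos_right (hc t ht).1 hx.le, (hc t ht).2⟩) hc0 hcT hpos hno
  refine ⟨Pb, ⟨hPb, hPb0, hPbd, hright, ?_⟩, ?_⟩
  · obtain ⟨G, hG, hG0, hPG⟩ := exists_analyticAt_localInverse hPb hPb0 hPbd.ne'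
    have hGt : Tendsto G (𝓝 0) (𝓝 0) := by simpa [hG0] using hG.continuousAt.tendsto
    filter_upwards [self_mem_nhdsWithin, nhdsWithin_le_nhds hsmall, nhdsWithin_le_nhds hPG,
      nhdsWithin_le_nhds (hGt.eventually hspiral)] with x₀ hx hxε hPGx hsp
    have hx : x₀ < 0 := hx
    have hG_ne : G x₀ ≠ 0 := fun h => by
      rw [h, hPb0] at hPGx
      exact hx.ne hPGx.symm
    obtain ⟨hpos, c, m, hm, hc, hc0, hcT, hno⟩ := hsp hG_ne
    rw [hPGx] at hpos hcT
    have hG_neg : G x₀ < 0 := neg_of_mul_pos_left hpos hx.le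
    have hrev : MapsTo (fun t : ℝ => 2 * Real.pi - t) (Icc 0 (2 * Real.pi))
        (Icc 0 (2 * Real.pi)) := fun t ht => ⟨by linarith [ht.2], by linarith [ht.1]⟩
    have hPx : P x₀ δ = G x₀ := by
      refine hhit x₀ hx.ne hxε (fun t => c (2 * Real.pi - t)) (fun t => -m (2 * Real.pi - t))
        (G x₀) (hm.comp (by fun_prop) hrev).neg (fun t ht => ?_) (by simpa using hcT)
        (by simpa using hc0) (by rwa [mul_comm]) (fun t ht h => ?_)
      · obtain ⟨h1, h2, h3⟩ := hc _ (hrev ht)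
        refine ⟨neg_pos.2 (neg_of_mul_pos_right h1 hG_neg.le), h2, ?_⟩
        rw [neg_smul]
        exact hasDerivWithinAt_comp_const_sub_Icc h3
      · have h1 := hno (2 * Real.pi - t) ⟨by linarith [ht.2], by linarith [ht.1]⟩ h
        exact mul_neg_of_neg_of_pos hx (pos_of_mul_neg_right h1 hG_neg.le)
    rw [hPx, hPGx]
  · rintro Pb' ⟨hPb', -, -, hright', -⟩
    refine (hPb'.frequently_eq_iff_eventually_eq hPb).1 ?_
    have h : ∀ᶠ x in nhdsWithin (0 : ℝ) (Ioi 0), Pb' x = Pb x := by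
      filter_upwards [hright, hright'] with x h1 h2 using h2.symm.trans h1
    exact h.frequently.filter_mono (nhdsWithin_mono _ fun x hx => ne_of_gt hx)
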